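/- Fix integers N ≥ 1, p ≥ 2 and a real β, set θ = tanh β, and for α > 0 set γ = α^{p−1}. With A_N(α,β) = (1/N) Σ_{k=0}^∞ e^{−γN}(γN)^k/k! · N^{−pk} Σ_{I:{1,…,k}→{1,…,N}^p} ln Z_N(I,β), the map α ↦ A_N(α,β) is differentiable and dA_N(α,β)/dα = (p−1)α^{p−2} [ ln cosh β − Σ_{n=1}^∞ ((−1)^n/n) θ^n ⟨q_{1,…,n}^p⟩_N ], where ⟨q_{1,…,n}^p⟩_N denotes the quenched expectation of the n-fold replicated Gibbs average Ω_I( (N^{−1} Σ_{i=1}^N Π_{a=1}^n σ^a_i)^p ), and the series on the right-hand side converges absolutely since |θ| < 1. -/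

import Mathlib

open scoped BigOperators

noncomputable section

/-- The value of a Boolean spin: `true ↦ 1`, `false ↦ -1`. -/
def spin (b : Bool) : ℝ := if b then 1 else -1

/-- Poisson probability mass function with mean `c`. -/
def poisProb (c : ℝ) (k : ℕ) : ℝ := Real.exp (-c) * c ^ k / (Nat.factorial k)

/-- Diluted p-spin energy (minus the Hamiltonian) for an index family `I`. -/
def energy (N p k : ℕ) (I : Fin k → Fin p → Fin N) (σ : Fin N → Bool) : ℝ :=
  ∑ ν : Fin k, ∏ j : Fin p, spin (σ (I ν j))

/-- Diluted p-spin partition function `Z_N(I, β)`. -/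
def Zdil (N p k : ℕ) (β : ℝ) (I : Fin k → Fin p → Fin N) : ℝ :=
  ∑ σ : Fin N → Bool, Real.exp (β * energy N p k I σ)

/-- Finite-volume quenched pressure `A_N(γ, β)`. -/
def pressure (N p : ℕ) (β γ : ℝ) : ℝ :=
  (1 / (N : ℝ)) * ∑' k : ℕ, poisProb (γ * N) k * ((N : ℝ) ^ (p * k))⁻¹ *
    ∑ I : Fin k → Fin p → Fin N, Real.log (Zdil N p k β I)

/-- `p`-th power of the multi-overlap `q_{1,…,n}` of `n` replicas. -/
def overlapPow (N n p : ℕ) (τ : Fin n → Fin N → Bool) : ℝ :=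
  ((N : ℝ)⁻¹ * ∑ i : Fin N, ∏ a : Fin n, spin (τ a i)) ^ p

/-- `n`-fold replicated Boltzmann average `Ω_I(G)` of the diluted p-spin system. -/
def replicaAvgI (N p k n : ℕ) (β : ℝ) (I : Fin k → Fin p → Fin N)
    (G : (Fin n → Fin N → Bool) → ℝ) : ℝ :=
  (∑ τ : Fin n → Fin N → Bool, G τ * ∏ a : Fin n, Real.exp (β * energy N p k I (τ a))) /
    (Zdil N p k β I) ^ n

/-- Quenched expectation `⟨q_{1,…,n}^p⟩_N` of the replicated multi-overlap power. -/
def overlapMoment (N p n : ℕ) (β γ : ℝ) : ℝ :=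
  ∑' k : ℕ, poisProb (γ * N) k * ((N : ℝ) ^ (p * k))⁻¹ *
    ∑ I : Fin k → Fin p → Fin N, replicaAvgI N p k n β I (overlapPow N n p)

open Finset

/-- Average over uniform i.i.d. index families. -/
def indexAvg (N p k : ℕ) (F : (Fin k → Fin p → Fin N) → ℝ) : ℝ :=
  ((N : ℝ) ^ (p * k))⁻¹ * ∑ I : Fin k → Fin p → Fin N, F I

/-- The interaction `∏ j, σ (x j)` attached to an index tuple `x`. -/
def spinProd {N p : ℕ} (x : Fin p → Fin N) (σ : Fin N → Bool) : ℝ :=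
  ∏ j : Fin p, spin (σ (x j))

/-- The Boltzmann state `ω_I`. -/
def gibbs (N p k : ℕ) (β : ℝ) (I : Fin k → Fin p → Fin N) (g : (Fin N → Bool) → ℝ) : ℝ :=
  (∑ σ : Fin N → Bool, g σ * Real.exp (β * energy N p k I σ)) / Zdil N p k β I

section Poisson

/-- Differentiation of a Poisson expectation with respect to the mean, for observables of at most
geometric growth. -/
theorem hasDerivAt_tsum_poisProb {f : ℕ → ℝ} {C r : ℝ} (hf : ∀ k, |f k| ≤ C * r ^ k) (c : ℝ) :
    HasDerivAt (fun c => ∑' k, poisProb c k * f k)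
      (∑' k, poisProb c k * (f (k + 1) - f k)) c := by
  have hsum : ∀ y : ℝ, Summable fun k => y ^ k / (k.factorial : ℝ) * f k := fun y => by
    refine .of_norm_bounded ((Real.summable_pow_div_factorial (|y| * r)).mul_left C) fun k => ?_
    rw [Real.norm_eq_abs, abs_mul, abs_div, abs_pow, Nat.abs_cast, mul_pow]
    calc |y| ^ k / (k.factorial : ℝ) * |f k| ≤ |y| ^ k / (k.factorial : ℝ) * (C * r ^ k) := by
          gcongr; exact hf k
      _ = _ := by ring
  have hsum' : ∀ y : ℝ, Summable fun k => y ^ k / (k.factorial : ℝ) * f (k + 1) := fun y => by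
    refine .of_norm_bounded ((Real.summable_pow_div_factorial (|y| * r)).mul_left (C * r))
      fun k => ?_
    rw [Real.norm_eq_abs, abs_mul, abs_div, abs_pow, Nat.abs_cast, mul_pow]
    calc |y| ^ k / (k.factorial : ℝ) * |f (k + 1)|
        ≤ |y| ^ k / (k.factorial : ℝ) * (C * r ^ (k + 1)) := by gcongr; exact hf _
      _ = _ := by ring
  have hfac : ∀ (k : ℕ) (y : ℝ), ((k + 1 : ℕ) : ℝ) * y ^ k / ((k + 1).factorial : ℝ)
      = y ^ k / (k.factorial : ℝ) := fun k y => by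
    have : (k.factorial : ℝ) ≠ 0 := by positivity
    rw [Nat.factorial_succ]; push_cast; field_simp
  have hseries : HasDerivAt (fun y : ℝ => ∑' k, y ^ k / (k.factorial : ℝ) * f k)
      (∑' k : ℕ, (k : ℝ) * c ^ (k - 1) / (k.factorial : ℝ) * f k) c := by
    have hc : c ∈ Metric.ball (0 : ℝ) (|c| + 1) := by simp
    refine hasDerivAt_tsum_of_isPreconnected
      (g := fun (k : ℕ) (y : ℝ) => y ^ k / (k.factorial : ℝ) * f k)
      (g' := fun (k : ℕ) (y : ℝ) => (k : ℝ) * y ^ (k - 1) / (k.factorial : ℝ) * f k)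
      (u := fun k : ℕ => (k : ℝ) * (|c| + 1) ^ (k - 1) / (k.factorial : ℝ) * |f k|) ?_
      Metric.isOpen_ball (convex_ball _ _).isPreconnected ?_ ?_ hc (hsum c) hc
    · rw [← summable_nat_add_iff 1]
      refine (hsum' (|c| + 1)).abs.congr fun k => ?_
      rw [add_tsub_cancel_right, hfac, abs_mul, abs_of_nonneg (by positivity)]
    · intro k y _
      exact ((hasDerivAt_pow k y).div_const _).mul_const _
    · intro k y hy
      have hy' : |y| ≤ |c| + 1 := by simpa using (mem_ball_zero_iff.1 hy).le
      rw [Real.norm_eq_abs, abs_mul, abs_div, abs_mul, abs_pow, Nat.abs_cast, Nat.abs_cast]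
      gcongr
  have hshift : (∑' k : ℕ, (k : ℝ) * c ^ (k - 1) / (k.factorial : ℝ) * f k)
      = ∑' k, c ^ k / (k.factorial : ℝ) * f (k + 1) := by
    rw [Summable.tsum_eq_zero_add]
    · simp only [add_tsub_cancel_right, hfac]
      simp
    · rw [← summable_nat_add_iff 1]
      refine (hsum' c).congr fun k => ?_
      rw [add_tsub_cancel_right, hfac]
  rw [hshift] at hseries
  have hexp : HasDerivAt (fun y : ℝ => Real.exp (-y)) (-Real.exp (-c)) c := by
    simpa using (hasDerivAt_neg c).exp
  convert! hexp.mul hseries using 1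
  · ext y
    rw [Pi.mul_apply, ← tsum_mul_left]
    exact tsum_congr fun k => by unfold poisProb; ring
  · rw [neg_mul, ← tsum_mul_left, ← tsum_mul_left, ← tsum_neg,
      ← ((hsum c).mul_left _).neg.tsum_add ((hsum' c).mul_left _)]
    exact tsum_congr fun k => by unfold poisProb; ring

theorem hasSum_poisProb (c : ℝ) : HasSum (poisProb c) 1 := by
  have h := (NormedSpace.expSeries_div_hasSum_exp c).mul_left (Real.exp (-c))
  rw [← Real.exp_eq_exp_ℝ, ← Real.exp_add, neg_add_cancel, Real.exp_zero] at h
  exact h.congr_fun fun k => by unfold poisProb; ring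

theorem poisProb_nonneg {c : ℝ} (hc : 0 ≤ c) (k : ℕ) : 0 ≤ poisProb c k := by
  unfold poisProb; positivity

end Poisson

section IndexAvg

variable {N p k : ℕ}

theorem indexAvg_add (F G : (Fin k → Fin p → Fin N) → ℝ) :
    indexAvg N p k (fun I => F I + G I) = indexAvg N p k F + indexAvg N p k G := by
  simp only [indexAvg, sum_add_distrib, mul_add]

theorem indexAvg_const (hN : 1 ≤ N) (c : ℝ) : indexAvg N p k (fun _ => c) = c := by
  have : (N : ℝ) ≠ 0 := by positivity
  simp only [indexAvg, sum_const, card_univ, Fintype.card_pi, Fintype.card_fin, prod_const,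
    nsmul_eq_mul, Nat.cast_pow, pow_mul]
  field_simp

theorem abs_indexAvg_le (hN : 1 ≤ N) {F : (Fin k → Fin p → Fin N) → ℝ} {C : ℝ}
    (hF : ∀ I, |F I| ≤ C) : |indexAvg N p k F| ≤ C := by
  rw [← indexAvg_const (k := k) (p := p) hN C]
  unfold indexAvg
  rw [abs_mul, abs_of_nonneg (by positivity : 0 ≤ ((N : ℝ) ^ (p * k))⁻¹)]
  gcongr
  exact (abs_sum_le_sum_abs _ _).trans (sum_le_sum fun I _ => hF I)

theorem indexAvg_succ (F : (Fin (k + 1) → Fin p → Fin N) → ℝ) :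
    indexAvg N p (k + 1) F =
      indexAvg N p k fun I => ((N : ℝ) ^ p)⁻¹ * ∑ x : Fin p → Fin N, F (Fin.cons x I) := by
  unfold indexAvg
  rw [← (Fin.consEquiv fun _ => Fin p → Fin N).sum_comp, Fintype.sum_prod_type, sum_comm,
    ← mul_sum, ← mul_assoc, ← mul_inv, ← pow_add, mul_add, mul_one]
  rfl

theorem hasSum_indexAvg {F : ℕ → (Fin k → Fin p → Fin N) → ℝ}
    {G : (Fin k → Fin p → Fin N) → ℝ} (h : ∀ I, HasSum (fun n => F n I) (G I)) :
    HasSum (fun n => indexAvg N p k (F n)) (indexAvg N p k G) :=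
  (hasSum_sum fun I _ => h I).mul_left _

end IndexAvg

section Gibbs

variable {N p k : ℕ} (β : ℝ)

theorem spin_eq_one_or (b : Bool) : spin b = 1 ∨ spin b = -1 := by
  cases b <;> simp [spin]

theorem spinProd_eq_one_or (x : Fin p → Fin N) (σ : Fin N → Bool) :
    spinProd x σ = 1 ∨ spinProd x σ = -1 := by
  rw [← abs_eq zero_le_one, spinProd, abs_prod]
  exact prod_eq_one fun j _ => (abs_eq zero_le_one).2 (spin_eq_one_or _)

theorem abs_spinProd (x : Fin p → Fin N) (σ : Fin N → Bool) : |spinProd x σ| = 1 :=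
  (abs_eq zero_le_one).2 (spinProd_eq_one_or x σ)

theorem abs_energy_le (I : Fin k → Fin p → Fin N) (σ : Fin N → Bool) :
    |energy N p k I σ| ≤ k := by
  refine (abs_sum_le_sum_abs _ _).trans ?_
  exact (sum_le_card_nsmul univ _ 1 fun ν _ => (abs_spinProd (I ν) σ).le).trans_eq (by simp)

theorem energy_cons (x : Fin p → Fin N) (I : Fin k → Fin p → Fin N) (σ : Fin N → Bool) :
    energy N p (k + 1) (Fin.cons x I) σ = spinProd x σ + energy N p k I σ := by
  simp [energy, spinProd, Fin.sum_univ_succ]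

theorem Zdil_pos (I : Fin k → Fin p → Fin N) : 0 < Zdil N p k β I :=
  sum_pos (fun _ _ => Real.exp_pos _) univ_nonempty

theorem abs_log_Zdil_le (I : Fin k → Fin p → Fin N) :
    |Real.log (Zdil N p k β I)| ≤ N * Real.log 2 + |β| * k := by
  have hE : ∀ σ, |β * energy N p k I σ| ≤ |β| * k := fun σ => by
    rw [abs_mul]; gcongr; exact abs_energy_le I σ
  have hconst : ∀ t : ℝ, Real.log (∑ _σ : Fin N → Bool, Real.exp t) = N * Real.log 2 + t :=
    fun t => by
      simp only [sum_const, card_univ, Fintype.card_pi, Fintype.card_bool, prod_const,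
        Fintype.card_fin, nsmul_eq_mul, Nat.cast_pow, Nat.cast_ofNat]
      rw [Real.log_mul (by positivity) (by positivity), Real.log_pow, Real.log_exp]
  have hup : Real.log (Zdil N p k β I) ≤ N * Real.log 2 + |β| * k := by
    rw [← hconst]
    refine Real.log_le_log (Zdil_pos β I) (sum_le_sum fun σ _ => ?_)
    exact Real.exp_le_exp.2 ((le_abs_self _).trans (hE σ))
  have hlo : N * Real.log 2 + -(|β| * k) ≤ Real.log (Zdil N p k β I) := by
    rw [← hconst]
    refine Real.log_le_log (sum_pos (fun _ _ => Real.exp_pos _) univ_nonempty)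
      (sum_le_sum fun σ _ => ?_)
    exact Real.exp_le_exp.2 (neg_le_of_abs_le (hE σ))
  have h2 : 0 ≤ N * Real.log 2 := by positivity
  rw [abs_le]
  constructor <;> linarith

theorem abs_gibbs_spinProd_le (I : Fin k → Fin p → Fin N) (x : Fin p → Fin N) :
    |gibbs N p k β I (spinProd x)| ≤ 1 := by
  rw [gibbs, abs_div, abs_of_pos (Zdil_pos β I), div_le_one (Zdil_pos β I)]
  refine (abs_sum_le_sum_abs _ _).trans (sum_le_sum fun σ _ => ?_)
  rw [abs_mul, abs_spinProd, one_mul, Real.abs_exp]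

theorem exp_mul_spinProd (x : Fin p → Fin N) (σ : Fin N → Bool) :
    Real.exp (β * spinProd x σ) = Real.cosh β * (1 + Real.tanh β * spinProd x σ) := by
  have hc := (Real.cosh_pos β).ne'
  have hs := Real.cosh_add_sinh β
  have hd := Real.cosh_sub_sinh β
  rw [Real.tanh_eq_sinh_div_cosh, mul_add, mul_one, ← mul_assoc, mul_div_cancel₀ _ hc]
  rcases spinProd_eq_one_or x σ with h | h <;> rw [h]
  · simp [hs]
  · simpa [sub_eq_add_neg] using hd.symm

theorem Zdil_cons (x : Fin p → Fin N) (I : Fin k → Fin p → Fin N) :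
    Zdil N p (k + 1) β (Fin.cons x I) =
      Zdil N p k β I * (Real.cosh β * (1 + Real.tanh β * gibbs N p k β I (spinProd x))) := by
  have hZ := (Zdil_pos β I).ne'
  have hg : Zdil N p k β I * gibbs N p k β I (spinProd x)
      = ∑ σ, spinProd x σ * Real.exp (β * energy N p k I σ) := mul_div_cancel₀ _ hZ
  calc Zdil N p (k + 1) β (Fin.cons x I)
      = ∑ σ, Real.cosh β * (Real.exp (β * energy N p k I σ)
          + Real.tanh β * (spinProd x σ * Real.exp (β * energy N p k I σ))) := by
        refine sum_congr rfl fun σ _ => ?_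
        rw [energy_cons, mul_add, Real.exp_add, exp_mul_spinProd]
        ring
    _ = Real.cosh β * (Zdil N p k β I
          + Real.tanh β * (Zdil N p k β I * gibbs N p k β I (spinProd x))) := by
        rw [hg, ← mul_sum, sum_add_distrib, ← mul_sum, Zdil]
    _ = _ := by ring

theorem abs_tanh_mul_gibbs_lt_one (I : Fin k → Fin p → Fin N) (x : Fin p → Fin N) :
    |Real.tanh β * gibbs N p k β I (spinProd x)| < 1 := by
  rw [abs_mul]
  exact (mul_le_of_le_one_right (abs_nonneg _) (abs_gibbs_spinProd_le β I x)).trans_lt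
    (Real.abs_tanh_lt_one β)

theorem log_Zdil_cons (x : Fin p → Fin N) (I : Fin k → Fin p → Fin N) :
    Real.log (Zdil N p (k + 1) β (Fin.cons x I)) = Real.log (Zdil N p k β I) +
      (Real.log (Real.cosh β) + Real.log (1 + Real.tanh β * gibbs N p k β I (spinProd x))) := by
  have h := (abs_lt.1 (abs_tanh_mul_gibbs_lt_one β I x)).1
  rw [Zdil_cons, Real.log_mul (Zdil_pos β I).ne', Real.log_mul (Real.cosh_pos β).ne']
  · linarith
  · exact mul_ne_zero (Real.cosh_pos β).ne' (by linarith)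

theorem hasSum_log_gibbs (I : Fin k → Fin p → Fin N) (x : Fin p → Fin N) :
    HasSum (fun n : ℕ => ((-1 : ℝ) ^ (n + 1) / (n + 1)) * Real.tanh β ^ (n + 1) *
        gibbs N p k β I (spinProd x) ^ (n + 1))
      (-Real.log (1 + Real.tanh β * gibbs N p k β I (spinProd x))) := by
  have h := Real.hasSum_pow_div_log_of_abs_lt_one
    (x := -(Real.tanh β * gibbs N p k β I (spinProd x)))
    (by rw [abs_neg]; exact abs_tanh_mul_gibbs_lt_one β I x)
  rw [sub_neg_eq_add] at h
  exact h.congr_fun fun n => by rw [neg_pow (_ * _), mul_pow]; ring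

/-- The multi-overlap power as an average of products over random index tuples. -/
theorem overlapPow_eq (n : ℕ) (τ : Fin n → Fin N → Bool) :
    overlapPow N n p τ =
      ((N : ℝ) ^ p)⁻¹ * ∑ x : Fin p → Fin N, ∏ a : Fin n, spinProd x (τ a) := by
  rw [overlapPow, mul_pow, inv_pow, Fintype.sum_pow]
  simp only [spinProd]
  congr 1
  exact sum_congr rfl fun x _ => prod_comm

theorem replicaAvgI_overlapPow (n : ℕ) (I : Fin k → Fin p → Fin N) :
    replicaAvgI N p k n β I (overlapPow N n p) =
      ((N : ℝ) ^ p)⁻¹ * ∑ x : Fin p → Fin N, gibbs N p k β I (spinProd x) ^ n := by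
  have hpow : ∀ x : Fin p → Fin N, gibbs N p k β I (spinProd x) ^ n =
      (∑ τ : Fin n → Fin N → Bool, (∏ a, spinProd x (τ a)) *
        ∏ a, Real.exp (β * energy N p k I (τ a))) / Zdil N p k β I ^ n := fun x => by
    rw [gibbs, div_pow, Fintype.sum_pow]
    simp only [prod_mul_distrib]
  simp only [hpow, replicaAvgI, overlapPow_eq]
  rw [← sum_div, sum_comm, ← mul_div_assoc, mul_sum]
  congr 1
  exact sum_congr rfl fun τ _ => by rw [mul_assoc, sum_mul]

theorem abs_replicaAvgI_overlapPow_le (hN : 1 ≤ N) (n : ℕ) (I : Fin k → Fin p → Fin N) :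
    |replicaAvgI N p k n β I (overlapPow N n p)| ≤ 1 := by
  have hN0 : (0 : ℝ) < N := by positivity
  rw [replicaAvgI_overlapPow, abs_mul, abs_of_pos (by positivity : 0 < ((N : ℝ) ^ p)⁻¹),
    inv_mul_le_iff₀ (by positivity), mul_one]
  refine (abs_sum_le_sum_abs _ _).trans ((sum_le_card_nsmul _ _ 1 fun x _ => ?_).trans_eq ?_)
  · rw [abs_pow]
    exact pow_le_one₀ (abs_nonneg _) (abs_gibbs_spinProd_le β I x)
  · simp

theorem indexAvg_log_Zdil_succ (hN : 1 ≤ N) :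
    indexAvg N p (k + 1) (fun I => Real.log (Zdil N p (k + 1) β I)) =
      indexAvg N p k (fun I => Real.log (Zdil N p k β I)) + (Real.log (Real.cosh β) +
        indexAvg N p k fun I => ((N : ℝ) ^ p)⁻¹ * ∑ x : Fin p → Fin N,
          Real.log (1 + Real.tanh β * gibbs N p k β I (spinProd x))) := by
  have hN0 : (N : ℝ) ≠ 0 := by positivity
  have hconst : ∀ c : ℝ, ((N : ℝ) ^ p)⁻¹ * ∑ _x : Fin p → Fin N, c = c := fun c => by
    simp [hN0]
  simp only [indexAvg_succ, log_Zdil_cons, sum_add_distrib, mul_add, hconst, indexAvg_add,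
    indexAvg_const hN]

theorem hasSum_indexAvg_overlapPow (hN : 1 ≤ N) :
    HasSum (fun n : ℕ => ((-1 : ℝ) ^ (n + 1) / (n + 1)) * Real.tanh β ^ (n + 1) *
        indexAvg N p k fun I => replicaAvgI N p k (n + 1) β I (overlapPow N (n + 1) p))
      (Real.log (Real.cosh β) -
        (indexAvg N p (k + 1) (fun I => Real.log (Zdil N p (k + 1) β I)) -
          indexAvg N p k (fun I => Real.log (Zdil N p k β I)))) := by
  have h := hasSum_indexAvg fun I : Fin k → Fin p → Fin N =>
    (hasSum_sum fun x (_ : x ∈ univ) => hasSum_log_gibbs β I x).mul_left ((N : ℝ) ^ p)⁻¹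
  convert! h using 1
  · ext n
    simp only [replicaAvgI_overlapPow, indexAvg, mul_sum]
    refine sum_congr rfl fun I _ => sum_congr rfl fun x _ => ?_
    ring
  · rw [indexAvg_log_Zdil_succ β hN]
    simp only [indexAvg, sum_neg_distrib, mul_neg]
    ring

end Gibbs

section Quenched

variable {N p : ℕ} (β : ℝ)

theorem pressure_eq (γ : ℝ) : pressure N p β γ = (1 / (N : ℝ)) * ∑' k, poisProb (γ * N) k *
    indexAvg N p k (fun I => Real.log (Zdil N p k β I)) := by
  simp only [pressure, indexAvg, mul_assoc]

theorem overlapMoment_eq (n : ℕ) (γ : ℝ) :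
    overlapMoment N p n β γ = ∑' k, poisProb (γ * N) k *
      indexAvg N p k (fun I => replicaAvgI N p k n β I (overlapPow N n p)) := by
  simp only [overlapMoment, indexAvg, mul_assoc]

theorem abs_coeff_le (n : ℕ) :
    |((-1 : ℝ) ^ (n + 1) / (n + 1)) * Real.tanh β ^ (n + 1)| ≤ |Real.tanh β| ^ (n + 1) := by
  rw [abs_mul, abs_div, abs_pow, abs_pow, abs_neg, abs_one, one_pow]
  refine mul_le_of_le_one_left (by positivity) ?_
  rw [abs_of_pos (by positivity : (0 : ℝ) < n + 1)]
  exact (div_le_one (by positivity)).2 (by linarith [(Nat.cast_nonneg n : (0 : ℝ) ≤ n)])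

theorem summable_abs_tanh_pow_succ : Summable fun n : ℕ => |Real.tanh β| ^ (n + 1) :=
  (summable_nat_add_iff 1).2
    (summable_geometric_of_lt_one (abs_nonneg _) (Real.abs_tanh_lt_one β))

theorem summable_coeff_mul_poisProb (hN : 1 ≤ N) {c : ℝ} (hc : 0 ≤ c) :
    Summable fun q : ℕ × ℕ => ((-1 : ℝ) ^ (q.1 + 1) / (q.1 + 1)) * Real.tanh β ^ (q.1 + 1) *
      (poisProb c q.2 * indexAvg N p q.2
        fun I => replicaAvgI N p q.2 (q.1 + 1) β I (overlapPow N (q.1 + 1) p)) := by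
  refine .of_norm_bounded ((summable_abs_tanh_pow_succ β).mul_of_nonneg
    (hasSum_poisProb c).summable (fun n => by positivity) (poisProb_nonneg hc)) fun q => ?_
  rw [Real.norm_eq_abs, abs_mul, abs_mul (poisProb c q.2), abs_of_nonneg (poisProb_nonneg hc q.2)]
  refine mul_le_mul (abs_coeff_le β q.1) (mul_le_of_le_one_right (poisProb_nonneg hc q.2) ?_)
    (mul_nonneg (poisProb_nonneg hc q.2) (abs_nonneg _)) (by positivity)
  exact abs_indexAvg_le hN fun I => abs_replicaAvgI_overlapPow_le β hN _ I

theorem tsum_poisProb_mul_sub (hN : 1 ≤ N) {γ : ℝ} (hγ : 0 ≤ γ) :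
    ∑' k, poisProb (γ * N) k *
        (indexAvg N p (k + 1) (fun I => Real.log (Zdil N p (k + 1) β I)) -
          indexAvg N p k (fun I => Real.log (Zdil N p k β I))) =
      Real.log (Real.cosh β) - ∑' n : ℕ, ((-1 : ℝ) ^ (n + 1) / (n + 1)) *
        Real.tanh β ^ (n + 1) * overlapMoment N p (n + 1) β γ := by
  have hs := summable_coeff_mul_poisProb (p := p) β hN (by positivity : 0 ≤ γ * N)
  have hP := hasSum_poisProb (γ * N)
  have hk : ∀ k, ∑' n : ℕ, ((-1 : ℝ) ^ (n + 1) / (n + 1)) * Real.tanh β ^ (n + 1) *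
      (poisProb (γ * N) k * indexAvg N p k
        fun I => replicaAvgI N p k (n + 1) β I (overlapPow N (n + 1) p)) =
      poisProb (γ * N) k * (Real.log (Real.cosh β) -
        (indexAvg N p (k + 1) (fun I => Real.log (Zdil N p (k + 1) β I)) -
          indexAvg N p k (fun I => Real.log (Zdil N p k β I)))) := fun k => by
    rw [← (hasSum_indexAvg_overlapPow β hN).tsum_eq, ← tsum_mul_left]
    exact tsum_congr fun n => by ring
  have hsk := hs.prod_symm.prod
  simp only [Prod.swap_prod_mk, hk] at hsk
  simp only [overlapMoment_eq, ← tsum_mul_left]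
  rw [← hs.tsum_comm]
  simp only [hk]
  have hc := hP.mul_right (Real.log (Real.cosh β))
  rw [one_mul] at hc
  refine (hc.sub hsk.hasSum).tsum_eq ▸ tsum_congr fun k => by ring

theorem summable_coeff_mul_overlapMoment (hN : 1 ≤ N) {γ : ℝ} (hγ : 0 ≤ γ) :
    Summable fun n : ℕ => |((-1 : ℝ) ^ (n + 1) / (n + 1)) * Real.tanh β ^ (n + 1) *
      overlapMoment N p (n + 1) β γ| := by
  have hs := (summable_coeff_mul_poisProb (p := p) β hN (by positivity : 0 ≤ γ * N)).prod
  simp only [tsum_mul_left, ← overlapMoment_eq] at hs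
  exact hs.abs

theorem hasDerivAt_pressure (hN : 1 ≤ N) {γ : ℝ} (hγ : 0 ≤ γ) :
    HasDerivAt (pressure N p β) (Real.log (Real.cosh β) - ∑' n : ℕ,
      ((-1 : ℝ) ^ (n + 1) / (n + 1)) * Real.tanh β ^ (n + 1) *
        overlapMoment N p (n + 1) β γ) γ := by
  have hN0 : (N : ℝ) ≠ 0 := by positivity
  have hgrowth : ∀ k, |indexAvg N p k (fun I => Real.log (Zdil N p k β I))| ≤
      (N * Real.log 2 + |β|) * 2 ^ k := fun k => by
    refine abs_indexAvg_le hN fun I => (abs_log_Zdil_le β I).trans ?_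
    have h1 : (1 : ℝ) ≤ 2 ^ k := one_le_pow₀ one_le_two
    have h2 : (k : ℝ) ≤ 2 ^ k := by exact_mod_cast Nat.lt_two_pow_self.le
    have h3 : 0 ≤ N * Real.log 2 := by positivity
    rw [add_mul]
    exact add_le_add (le_mul_of_one_le_right h3 h1) (by gcongr)
  have h := ((hasDerivAt_tsum_poisProb hgrowth (γ * N)).comp γ
    (hasDerivAt_mul_const (N : ℝ))).const_mul (1 / (N : ℝ))
  rw [tsum_poisProb_mul_sub β hN hγ] at h
  convert! h using 1
  · ext y
    exact pressure_eq β y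
  · field_simp

end Quenched

/-- **Connectivity derivative of the quenched pressure in terms of multi-overlaps**
(with `γ = α^{p−1}`):
`dA_N/dα = (p−1)α^{p−2}[ln cosh β − Σ_{n≥1} ((−1)ⁿ/n) θⁿ ⟨q_{1,…,n}^p⟩_N]`,
the series converging absolutely since `|θ| < 1`. -/
theorem pressure_deriv_alpha (N p : ℕ) (hN : 1 ≤ N) (hp : 2 ≤ p)
    (β : ℝ) (α : ℝ) (hα : 0 < α) :
    Summable (fun n : ℕ =>
      |((-1 : ℝ) ^ (n + 1) / (n + 1)) * Real.tanh β ^ (n + 1) *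
        overlapMoment N p (n + 1) β (α ^ (p - 1))|) ∧
    HasDerivAt (fun a : ℝ => pressure N p β (a ^ (p - 1)))
      (((p : ℝ) - 1) * α ^ (p - 2) *
        (Real.log (Real.cosh β) -
          ∑' n : ℕ, ((-1 : ℝ) ^ (n + 1) / (n + 1)) * Real.tanh β ^ (n + 1) *
            overlapMoment N p (n + 1) β (α ^ (p - 1))))
      α := by
  have hγ : 0 ≤ α ^ (p - 1) := by positivity
  refine ⟨summable_coeff_mul_overlapMoment β hN hγ, ?_⟩
  convert! (hasDerivAt_pressure (p := p) β hN hγ).comp α (hasDerivAt_pow (p - 1) α) using 1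
  rw [Nat.cast_sub (by omega), Nat.cast_one, Nat.sub_sub]
  ring
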